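/- arXiv:2210.12274 — 8 statements merged into one kernel-verified Lean document; each statement's English description precedes it below -/
import Mathlib

section
/- (Average-opinion recursion and self-cooling/self-exciting regimes.) Suppose the influence weights are doubly normalized (Σ_{j=1}^N w_{ji} = 1 for every i, and Σ_{i=1}^N w_{ji} = 1 for every j), each reaction satisfies β_i ∈ {−1, 1}, and γ ≥ 0. Let β = (1/N)·#{i : β_i = 1} and X̄_t = (1/N) Σ_{i=1}^N X_{i,t}. Then for every time t, X̄_{t+1} = (2β − 1)·γ·s̃_t + X̄_t. Consequently, if β ≤ 1/2 the average opinion is nonincreasing (X̄_{t+1} ≤ X̄_t for all t, the self-cooling regime), and if β ≥ 1/2 it is nondecreasing (X̄_{t+1} ≥ X̄_t for all t, the self-exciting regime). -/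
/-- A sum of signs is twice the number of positive signs minus the number of terms. -/
lemma sum_signs_eq_two_mul_card_sub {ι : Type*} [Fintype ι] (b : ι → ℝ)
    (hb : ∀ i, b i = 1 ∨ b i = -1) :
    ∑ i, b i = 2 * ((Finset.univ.filter fun i => b i = 1).card : ℝ) - Fintype.card ι := by
  have h : ∀ i, b i = 2 * (if b i = 1 then 1 else 0) - 1 := by
    intro i
    rcases hb i with h | h <;> rw [h] <;> norm_num
  rw [Finset.sum_congr rfl fun i _ => h i, Finset.sum_sub_distrib, ← Finset.mul_sum,
    Finset.sum_boole]
  simp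

/-- Averaging with weights whose outgoing sums are one preserves the total. -/
lemma sum_sum_mul_eq_sum {ι : Type*} [Fintype ι] (w : ι → ι → ℝ)
    (hw : ∀ j, ∑ i, w j i = 1) (x : ι → ℝ) :
    ∑ i, ∑ j, w j i * x j = ∑ j, x j := by
  rw [Finset.sum_comm]
  simp_rw [← Finset.sum_mul, hw, one_mul]

/-- **Average-opinion recursion and self-cooling/self-exciting regimes.**
With doubly normalized weights, reactions `β_i ∈ {−1,1}` and `γ ≥ 0`, the average
opinion satisfies `X̄_{t+1} = (2β − 1)·γ·s̃_t + X̄_t`, where `β` is the fraction of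
positively-reacting agents and `s̃_t` the fraction of agents in state 1.
Consequently the average opinion is nonincreasing when `β ≤ 1/2` (self-cooling)
and nondecreasing when `β ≥ 1/2` (self-exciting). -/
theorem gsm_degroot_average_opinion_regimes
    (N : ℕ) [NeZero N]
    (w : Fin N → Fin N → ℝ) (hw : ∀ j i, 0 ≤ w j i)
    (hsum_in : ∀ i, ∑ j, w j i = 1) (hsum_out : ∀ j, ∑ i, w j i = 1)
    (γ : ℝ) (hγ : 0 ≤ γ)
    (b : Fin N → ℝ) (hb : ∀ i, b i = 1 ∨ b i = -1)
    (s : Fin N → ℕ → ℝ) (hs : ∀ i t, s i t = 0 ∨ s i t = 1)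
    (X : Fin N → ℕ → ℝ)
    (hupd : ∀ i t, X i (t + 1) = b i * γ * ((1 / (N : ℝ)) * ∑ j, s j t) + ∑ j, w j i * X j t) :
    (∀ t : ℕ,
        (1 / (N : ℝ)) * ∑ i, X i (t + 1) =
          (2 * (((Finset.univ.filter fun i => b i = 1).card : ℝ) / N) - 1) * γ *
              ((1 / (N : ℝ)) * ∑ j, s j t) +
            (1 / (N : ℝ)) * ∑ i, X i t) ∧
    ((((Finset.univ.filter fun i => b i = 1).card : ℝ) / N ≤ 1 / 2 →
        ∀ t : ℕ, (1 / (N : ℝ)) * ∑ i, X i (t + 1) ≤ (1 / (N : ℝ)) * ∑ i, X i t)) ∧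
    ((1 / 2 ≤ ((Finset.univ.filter fun i => b i = 1).card : ℝ) / N →
        ∀ t : ℕ, (1 / (N : ℝ)) * ∑ i, X i t ≤ (1 / (N : ℝ)) * ∑ i, X i (t + 1))) := by
  have hN : (N : ℝ) ≠ 0 := NeZero.ne _
  have hrec : ∀ t : ℕ,
      (1 / (N : ℝ)) * ∑ i, X i (t + 1) =
        (2 * (((Finset.univ.filter fun i => b i = 1).card : ℝ) / N) - 1) * γ *
            ((1 / (N : ℝ)) * ∑ j, s j t) +
          (1 / (N : ℝ)) * ∑ i, X i t := by
    intro t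
    simp_rw [hupd]
    rw [Finset.sum_add_distrib, sum_sum_mul_eq_sum w hsum_out fun j => X j t,
      ← Finset.sum_mul, ← Finset.sum_mul, sum_signs_eq_two_mul_card_sub b hb, Fintype.card_fin]
    field_simp
  have hprop : ∀ t, 0 ≤ γ * ((1 / (N : ℝ)) * ∑ j, s j t) := by
    intro t
    have : 0 ≤ ∑ j, s j t := Finset.sum_nonneg fun j _ => by
      rcases hs j t with h | h <;> simp [h]
    positivity
  refine ⟨hrec, fun h t => ?_, fun h t => ?_⟩
  · rw [hrec t, mul_assoc]
    exact add_le_of_nonpos_left (mul_nonpos_of_nonpos_of_nonneg (by linarith) (hprop t))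
  · rw [hrec t, mul_assoc]
    exact le_add_of_nonneg_left (mul_nonneg (by linarith) (hprop t))
end

section
/- (Two diverging groups under pure GSM.) Assume the pure-GSM dynamics: almost surely, X_{i,t+1} = β_i·γ·S̃_t + X_{i,t} for all agents i and times t. Let β⁺ = {i : β_i = 1} and β⁻ = {i : β_i = −1}, and assume β⁺ ≠ ∅. Then for every i ∈ β⁺, E[X_{i,t}] → +∞ as t → ∞, and for every i ∈ β⁻, E[X_{i,t}] → −∞ as t → ∞. -/
open MeasureTheory Filter

/-- A real sequence whose increments are bounded below by a positive constant tends to `+∞`. -/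
theorem tendsto_atTop_of_add_le_succ {u : ℕ → ℝ} {c : ℝ} (hc : 0 < c)
    (hu : ∀ t, u t + c ≤ u (t + 1)) : Tendsto u atTop atTop := by
  have hlin : ∀ t : ℕ, u 0 + t * c ≤ u t := by
    intro t
    induction t with
    | zero => simp
    | succ t ih =>
      have := hu t
      push_cast
      linarith
  exact tendsto_atTop_mono hlin (tendsto_atTop_add_const_left _ _
    (tendsto_natCast_atTop_atTop.atTop_mul_const hc))

/-- The logistic function of a measurable real random variable is integrable. -/
theorem integrable_logistic {Ω : Type*} [MeasurableSpace Ω] {μ : Measure Ω} [IsFiniteMeasure μ]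
    {Y : Ω → ℝ} (hY : Measurable Y) (a : ℝ) :
    Integrable (fun ω => 1 / (1 + Real.exp (-a * Y ω))) μ := by
  refine Integrable.of_bound (C := 1) (Measurable.aestronglyMeasurable (by fun_prop))
    (Eventually.of_forall fun ω => ?_)
  have := Real.exp_pos (-a * Y ω)
  rw [Real.norm_of_nonneg (by positivity), div_le_one (by positivity)]
  linarith

/-- The logistic function of a measurable real random variable has positive expectation. -/
theorem integral_logistic_pos {Ω : Type*} [MeasurableSpace Ω] {μ : Measure Ω}
    [IsProbabilityMeasure μ] {Y : Ω → ℝ} (hY : Measurable Y) (a : ℝ) :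
    0 < ∫ ω, 1 / (1 + Real.exp (-a * Y ω)) ∂μ := by
  have hp : ∀ ω, 0 < 1 / (1 + Real.exp (-a * Y ω)) := fun ω => by positivity
  rw [integral_pos_iff_support_of_nonneg (fun ω => (hp ω).le) (integrable_logistic hY a)]
  have hsupp : Function.support (fun ω => 1 / (1 + Real.exp (-a * Y ω))) = Set.univ :=
    Set.eq_univ_of_forall fun ω => (hp ω).ne'
  rw [hsupp]
  simp

/-- **Two diverging groups under pure GSM.** Under the pure-GSM dynamics
`X_{i,t+1} = β_i·γ·S̃_t + X_{i,t}` (a.s.), with the event-generation mechanism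
`E[S_{i,t}] = E[1/(1+exp(−λ X_{i,t}))]`, if the set `β⁺ = {i : β_i = 1}` is
nonempty then `E[X_{i,t}] → +∞` for every `i ∈ β⁺` and `E[X_{i,t}] → −∞` for
every `i` with `β_i = −1`. -/
theorem pure_gsm_two_diverging_groups
    {Ω : Type*} [MeasurableSpace Ω] (ℙ : Measure Ω) [IsProbabilityMeasure ℙ]
    (N : ℕ) [NeZero N]
    (X : Fin N → ℕ → Ω → ℝ) (S : Fin N → ℕ → Ω → ℝ)
    (hXmeas : ∀ i t, Measurable (X i t)) (hXint : ∀ i t, Integrable (X i t) ℙ)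
    (hSmeas : ∀ i t, Measurable (S i t))
    (hS01 : ∀ i t ω, S i t ω = 0 ∨ S i t ω = 1)
    (lam γ : ℝ) (hlam : 0 < lam) (hγ : 0 < γ)
    (β : Fin N → ℝ)
    (hEGM : ∀ i t,
      ∫ ω, S i t ω ∂ℙ = ∫ ω, 1 / (1 + Real.exp (-lam * X i t ω)) ∂ℙ)
    (hdyn : ∀ᵐ ω ∂ℙ, ∀ (i : Fin N) (t : ℕ),
      X i (t + 1) ω = β i * γ * ((1 / (N : ℝ)) * ∑ j, S j t ω) + X i t ω)
    (hpos : ∃ i, β i = 1) :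
    (∀ i, β i = 1 →
        Tendsto (fun t => ∫ ω, X i t ω ∂ℙ) atTop atTop) ∧
    (∀ i, β i = -1 →
        Tendsto (fun t => ∫ ω, X i t ω ∂ℙ) atTop atBot) := by
  obtain ⟨k, hk⟩ := hpos
  have hN : (0 : ℝ) < N := Nat.cast_pos.mpr (NeZero.pos N)
  have hS0 : ∀ i t ω, 0 ≤ S i t ω := fun i t ω => by
    rcases hS01 i t ω with h | h <;> simp [h]
  have hSint : ∀ i t, Integrable (S i t) ℙ := fun i t =>
    Integrable.of_bound (C := 1) (hSmeas i t).aestronglyMeasurable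
      (Eventually.of_forall fun ω => by rcases hS01 i t ω with h | h <;> simp [h])
  have hmono : ∀ t, ∀ᵐ ω ∂ℙ, X k 0 ω ≤ X k t ω := by
    intro t
    filter_upwards [hdyn] with ω hω
    refine monotone_nat_of_le_succ (f := fun t => X k t ω) (fun n => ?_) (Nat.zero_le t)
    have hsum : 0 ≤ ∑ j, S j n ω := Finset.sum_nonneg fun j _ => hS0 j n ω
    have hinc : 0 ≤ β k * γ * ((1 / (N : ℝ)) * ∑ j, S j n ω) := by
      rw [hk]
      positivity
    simp only [hω k n]
    linarith
  have hlow : ∀ t, ∫ ω, S k 0 ω ∂ℙ ≤ ∑ j, ∫ ω, S j t ω ∂ℙ := by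
    intro t
    calc ∫ ω, S k 0 ω ∂ℙ ≤ ∫ ω, S k t ω ∂ℙ := by
          rw [hEGM, hEGM]
          refine integral_mono_ae (integrable_logistic (hXmeas k 0) lam)
            (integrable_logistic (hXmeas k t) lam) ?_
          filter_upwards [hmono t] with ω hω
          refine one_div_le_one_div_of_le (by positivity) ?_
          have hexp : Real.exp (-lam * X k t ω) ≤ Real.exp (-lam * X k 0 ω) :=
            Real.exp_le_exp.mpr (by nlinarith)
          linarith
      _ ≤ ∑ j, ∫ ω, S j t ω ∂ℙ :=
          Finset.single_le_sum (f := fun j => ∫ ω, S j t ω ∂ℙ)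
            (fun j _ => integral_nonneg (hS0 j t)) (Finset.mem_univ k)
  have hstep : ∀ i t, ∫ ω, X i (t + 1) ω ∂ℙ =
      β i * (γ * ((1 / (N : ℝ)) * ∑ j, ∫ ω, S j t ω ∂ℙ)) + ∫ ω, X i t ω ∂ℙ := by
    intro i t
    have hsumint : Integrable (fun ω => ∑ j, S j t ω) ℙ :=
      integrable_finsetSum _ fun j _ => hSint j t
    rw [integral_congr_ae (hdyn.mono fun ω hω => hω i t),
      integral_add ((hsumint.const_mul _).const_mul _) (hXint i t),
      integral_const_mul, integral_const_mul, integral_finsetSum _ fun j _ => hSint j t,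
      mul_assoc]
  have hS_pos : 0 < ∫ ω, S k 0 ω ∂ℙ := by
    rw [hEGM]
    exact integral_logistic_pos (hXmeas k 0) lam
  have hc : 0 < γ * ((1 / (N : ℝ)) * ∫ ω, S k 0 ω ∂ℙ) := by positivity
  have hle : ∀ t, γ * ((1 / (N : ℝ)) * ∫ ω, S k 0 ω ∂ℙ) ≤
      γ * ((1 / (N : ℝ)) * ∑ j, ∫ ω, S j t ω ∂ℙ) := fun t => by
    gcongr
    exact hlow t
  refine ⟨fun i hi => tendsto_atTop_of_add_le_succ hc fun t => ?_, fun i hi => ?_⟩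
  · rw [hstep, hi]
    linarith [hle t]
  · refine tendsto_neg_atTop_iff.mp (tendsto_atTop_of_add_le_succ hc fun t => ?_)
    rw [hstep, hi]
    linarith [hle t]
end

section
/- (Divergence of expectation from vanishing event probability.) Let (Y_t)_{t ∈ ℕ} be a sequence of integrable real-valued random variables on a probability space, λ > 0, and suppose the family of positive parts {max(Y_t, 0) : t ∈ ℕ} is uniformly integrable. If E[1/(1+exp(−λ Y_t))] → 0 as t → ∞, then E[Y_t] → −∞ as t → ∞. -/
open MeasureTheory Filter

/-- A real number is at most its positive part minus `K`, up to a multiple of its logistic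
activation. -/
theorem le_posPart_sub_add_mul_sigmoid {lam K : ℝ} (hlam : 0 < lam) (hK : 0 ≤ K) (y : ℝ) :
    y ≤ max y 0 - K +
      K * (1 + Real.exp (lam * K)) * (1 / (1 + Real.exp (-lam * y))) := by
  rcases le_total y (-K) with hy | hy
  · have h0 : 0 ≤ K * (1 + Real.exp (lam * K)) * (1 / (1 + Real.exp (-lam * y))) := by
      positivity
    linarith [le_max_right y 0]
  · have hexp : Real.exp (-lam * y) ≤ Real.exp (lam * K) :=
      Real.exp_le_exp.mpr (by nlinarith)
    have h1 : 1 ≤ (1 + Real.exp (lam * K)) * (1 / (1 + Real.exp (-lam * y))) := by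
      rw [mul_one_div, one_le_div (by positivity)]
      linarith
    nlinarith [le_max_left y 0]

/-- **Divergence of expectation from vanishing event probability.** If the positive
parts of an integrable sequence `(Y_t)` are uniformly integrable and the expected
logistic activation `E[1/(1+exp(−λ Y_t))]` tends to `0`, then `E[Y_t] → −∞`. -/
theorem mean_to_neg_infty_of_sigmoid_mean_to_zero
    {Ω : Type*} [MeasurableSpace Ω] (ℙ : Measure Ω) [IsProbabilityMeasure ℙ]
    (Y : ℕ → Ω → ℝ) (hYmeas : ∀ t, Measurable (Y t))
    (hYint : ∀ t, Integrable (Y t) ℙ)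
    (hUI : UniformIntegrable (fun t ω => max (Y t ω) 0) 1 ℙ)
    (lam : ℝ) (hlam : 0 < lam)
    (h : Tendsto (fun t => ∫ ω, 1 / (1 + Real.exp (-lam * Y t ω)) ∂ℙ)
      atTop (nhds 0)) :
    Tendsto (fun t => ∫ ω, Y t ω ∂ℙ) atTop atBot := by
  obtain ⟨-, -, C, hC⟩ := hUI
  have hpos_int : ∀ t, Integrable (fun ω => max (Y t ω) 0) ℙ := fun t => (hYint t).pos_part
  have hpos : ∀ t, ∫ ω, max (Y t ω) 0 ∂ℙ ≤ C := by
    intro t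
    have hnorm := hC t
    rw [eLpNorm_one_eq_lintegral_enorm] at hnorm
    calc ∫ ω, max (Y t ω) 0 ∂ℙ = ∫ ω, ‖max (Y t ω) 0‖ ∂ℙ := by
          simp only [Real.norm_of_nonneg (le_max_right _ _)]
      _ = (∫⁻ ω, ‖max (Y t ω) 0‖ₑ ∂ℙ).toReal :=
          integral_norm_eq_lintegral_enorm (hpos_int t).aestronglyMeasurable
      _ ≤ C := ENNReal.toReal_le_of_le_ofReal C.2 (by simpa using hnorm)
  have hsig : ∀ t, Integrable (fun ω => 1 / (1 + Real.exp (-lam * Y t ω))) ℙ := by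
    intro t
    have hmeas := hYmeas t
    refine Integrable.of_bound (C := 1)
      (Measurable.aestronglyMeasurable (by fun_prop)) (ae_of_all _ fun ω => ?_)
    rw [Real.norm_of_nonneg (by positivity), div_le_one (by positivity)]
    linarith [Real.exp_pos (-lam * Y t ω)]
  refine tendsto_atBot.mpr fun b => ?_
  set K : ℝ := max 0 (C + 1 - b)
  have hK : 0 ≤ K := le_max_left _ _
  have hKb : C + 1 - b ≤ K := le_max_right _ _
  have hlim := h.const_mul (K * (1 + Real.exp (lam * K)))
  rw [mul_zero] at hlim
  filter_upwards [hlim.eventually_lt_const one_pos] with t ht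
  have hshift : Integrable (fun ω => max (Y t ω) 0 - K) ℙ :=
    (hpos_int t).sub (integrable_const K)
  have hmul := (hsig t).const_mul (K * (1 + Real.exp (lam * K)))
  have hmono := integral_mono (hYint t) (hshift.add hmul)
    fun ω => le_posPart_sub_add_mul_sigmoid hlam hK (Y t ω)
  simp only [Pi.add_apply] at hmono
  rw [integral_add hshift hmul, integral_sub (hpos_int t) (integrable_const K),
    integral_const_mul, integral_const, probReal_univ, one_smul] at hmono
  linarith [hpos t]
end

section
/- (No local consensus.) Assume the GSM-DeGroot dynamics: almost surely, X_{i,t+1} = β_i·γ·S̃_t + Σ_{j=1}^N w_{ji} X_{j,t} for all agents i and times t, with nonnegative weights satisfying Σ_{j=1}^N w_{ji} = 1 for every i, reactions β_i ∈ {−1, 1} for all i, γ > 0 and λ > 0; assume also that for each agent i the family of positive parts {max(X_{i,t}, 0) : t ∈ ℕ} is uniformly integrable. Then there exists no agent i and no real number C such that E[X_{j,t}] → C as t → ∞ for every j in the closed neighborhood N(i) ∪ {i}, where N(i) = {j : w_{ji} > 0}. -/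
open MeasureTheory Filter

/-- If the logistic transforms of a sequence of integrable random variables have expectations
tending to zero and the positive parts are uniformly integrable, then the expectations of the
variables tend to `-∞`. -/
theorem tendsto_integral_atBot_of_logistic
    {Ω : Type*} [MeasurableSpace Ω] {μ : Measure Ω} [IsProbabilityMeasure μ]
    {Y : ℕ → Ω → ℝ} {a : ℝ} (ha : 0 < a)
    (hmeas : ∀ t, Measurable (Y t)) (hint : ∀ t, Integrable (Y t) μ)
    (hUI : UnifIntegrable (fun t ω => max (Y t ω) 0) 1 μ)
    (hlim : Tendsto (fun t => ∫ ω, 1 / (1 + Real.exp (-a * Y t ω)) ∂μ) atTop (nhds 0)) :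
    Tendsto (fun t => ∫ ω, Y t ω ∂μ) atTop atBot := by
  refine tendsto_atBot.2 fun b => ?_
  obtain ⟨M, hM, hMb⟩ : ∃ M : ℝ, 0 < M ∧ 2 - M ≤ b :=
    ⟨|b| + 2, by positivity, by linarith [neg_abs_le b]⟩
  obtain ⟨δ, hδ, hδUI⟩ := hUI (ε := 1) one_pos
  set A : ℕ → Set Ω := fun t => {ω | -M ≤ Y t ω}
  have hAmeas (t) : MeasurableSet (A t) := measurableSet_le measurable_const (hmeas t)
  set c : ℝ := 1 / (1 + Real.exp (a * M))
  have hcpos : 0 < c := by positivity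
  have hlogint (t) : Integrable (fun ω => 1 / (1 + Real.exp (-a * Y t ω))) μ := by
    refine Integrable.of_bound (C := 1) ?_ (ae_of_all _ fun ω => ?_)
    · have := hmeas t
      exact Measurable.aestronglyMeasurable (by fun_prop)
    · rw [Real.norm_of_nonneg (by positivity), div_le_one (by positivity)]
      linarith [Real.exp_pos (-a * Y t ω)]
  have hprob (t) : c * μ.real (A t) ≤ ∫ ω, 1 / (1 + Real.exp (-a * Y t ω)) ∂μ := by
    have hnonneg : 0 ≤ᵐ[μ] fun ω => 1 / (1 + Real.exp (-a * Y t ω)) :=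
      ae_of_all _ fun ω => by simp only [Pi.zero_apply]; positivity
    refine le_trans ?_ (mul_meas_ge_le_integral_of_nonneg hnonneg (hlogint t) c)
    refine mul_le_mul_of_nonneg_left ?_ hcpos.le
    refine measureReal_mono fun ω hω => ?_
    have hω' : -M ≤ Y t ω := hω
    change 1 / (1 + Real.exp (a * M)) ≤ 1 / (1 + Real.exp (-a * Y t ω))
    refine one_div_le_one_div_of_le (by positivity) ?_
    have := Real.exp_le_exp.2 (show -a * Y t ω ≤ a * M by nlinarith)
    linarith
  filter_upwards [hlim.eventually_lt_const (mul_pos hcpos (lt_min hδ (inv_pos.2 hM)))] with t ht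
  have hsmall : μ.real (A t) < min δ M⁻¹ := lt_of_mul_lt_mul_left ((hprob t).trans_lt ht) hcpos.le
  have hμA : μ (A t) ≤ ENNReal.ofReal δ := by
    rw [← ofReal_measureReal]
    exact ENNReal.ofReal_le_ofReal (hsmall.le.trans (min_le_left _ _))
  have hposint : Integrable ((A t).indicator fun ω => max (Y t ω) 0) μ :=
    (hint t).pos_part.indicator (hAmeas t)
  have hpos : ∫ ω, (A t).indicator (fun ω => max (Y t ω) 0) ω ∂μ ≤ 1 := by
    have h := hδUI t (A t) (hAmeas t) hμA
    rw [eLpNorm_one_eq_lintegral_enorm, ← ofReal_integral_norm_eq_lintegral_enorm hposint,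
      ENNReal.ofReal_le_ofReal_iff zero_le_one] at h
    exact (integral_mono hposint hposint.norm fun ω => Real.le_norm_self _).trans h
  have hindint : Integrable ((A t).indicator fun _ => M) μ :=
    (integrable_const M).indicator (hAmeas t)
  have hsumint : Integrable (fun ω =>
      (A t).indicator (fun ω => max (Y t ω) 0) ω + (A t).indicator (fun _ => M) ω) μ :=
    hposint.add hindint
  have hle : ∫ ω, Y t ω ∂μ ≤
      ∫ ω, ((A t).indicator (fun ω => max (Y t ω) 0) ω + (A t).indicator (fun _ => M) ω - M) ∂μ := by
    refine integral_mono (hint t) (hsumint.sub (integrable_const M)) fun ω => ?_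
    by_cases hω : ω ∈ A t
    · simp [hω]
    · have : Y t ω < -M := not_le.1 hω
      simpa [hω] using this.le
  rw [integral_sub hsumint (integrable_const M), integral_add hposint hindint,
    integral_indicator_const M (hAmeas t)] at hle
  have hM1 : μ.real (A t) * M ≤ 1 := by
    have := mul_le_mul_of_nonneg_right (hsmall.le.trans (min_le_right _ _)) hM.le
    rwa [inv_mul_cancel₀ hM.ne'] at this
  simp only [integral_const, probReal_univ, smul_eq_mul, one_mul] at hle
  linarith

/-- **No local consensus.** Under the GSM-DeGroot dynamics with normalized
nonnegative weights, reactions `β_i ∈ {−1,1}`, `γ > 0`, `λ > 0`, the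
event-generation mechanism, and uniformly integrable positive parts, no agent `i`
can have all expected opinions in its closed neighborhood converge to a common
finite value `C`. -/
theorem gsm_degroot_no_local_consensus
    {Ω : Type*} [MeasurableSpace Ω] (ℙ : Measure Ω) [IsProbabilityMeasure ℙ]
    (N : ℕ) [NeZero N]
    (X : Fin N → ℕ → Ω → ℝ) (S : Fin N → ℕ → Ω → ℝ)
    (hXmeas : ∀ i t, Measurable (X i t)) (hXint : ∀ i t, Integrable (X i t) ℙ)
    (hSmeas : ∀ i t, Measurable (S i t))
    (hS01 : ∀ i t ω, S i t ω = 0 ∨ S i t ω = 1)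
    (lam γ : ℝ) (hlam : 0 < lam) (hγ : 0 < γ)
    (β : Fin N → ℝ) (hβ : ∀ i, β i = 1 ∨ β i = -1)
    (w : Fin N → Fin N → ℝ) (hw : ∀ j i, 0 ≤ w j i)
    (hsum : ∀ i, ∑ j, w j i = 1)
    (hEGM : ∀ i t,
      ∫ ω, S i t ω ∂ℙ = ∫ ω, 1 / (1 + Real.exp (-lam * X i t ω)) ∂ℙ)
    (hdyn : ∀ᵐ ω ∂ℙ, ∀ (i : Fin N) (t : ℕ),
      X i (t + 1) ω = β i * γ * ((1 / (N : ℝ)) * ∑ j, S j t ω) + ∑ j, w j i * X j t ω)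
    (hUI : ∀ i, UniformIntegrable (fun t ω => max (X i t ω) 0) 1 ℙ) :
    ¬ ∃ (i : Fin N) (C : ℝ), ∀ j, (0 < w j i ∨ j = i) →
        Tendsto (fun t => ∫ ω, X j t ω ∂ℙ) atTop (nhds C) := by
  rintro ⟨i, C, hC⟩
  have hSint (j t) : Integrable (S j t) ℙ := by
    refine Integrable.of_bound (C := 1) (hSmeas j t).aestronglyMeasurable (ae_of_all _ fun ω => ?_)
    rcases hS01 j t ω with h | h <;> simp [h]
  have hSnonneg (j t) : 0 ≤ ∫ ω, S j t ω ∂ℙ := integral_nonneg fun ω => by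
    rcases hS01 j t ω with h | h <;> simp [h]
  have hmean (t) : ∫ ω, X i (t + 1) ω ∂ℙ =
      β i * γ * ((1 / (N : ℝ)) * ∑ j, ∫ ω, S j t ω ∂ℙ) + ∑ j, w j i * ∫ ω, X j t ω ∂ℙ := by
    have hsumS : Integrable (fun ω => ∑ j, S j t ω) ℙ := integrable_finsetSum _ fun j _ => hSint j t
    have hwX (j) : Integrable (fun ω => w j i * X j t ω) ℙ := (hXint j t).const_mul _
    rw [integral_congr_ae (hdyn.mono fun ω h => h i t),
      integral_add ((hsumS.const_mul _).const_mul _) (integrable_finsetSum _ fun j _ => hwX j),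
      integral_const_mul, integral_const_mul, integral_finsetSum _ fun j _ => hSint j t,
      integral_finsetSum _ fun j _ => hwX j]
    simp only [integral_const_mul]
  have hneigh : Tendsto (fun t => ∑ j, w j i * ∫ ω, X j t ω ∂ℙ) atTop (nhds C) := by
    have hterm : ∀ j ∈ Finset.univ,
        Tendsto (fun t => w j i * ∫ ω, X j t ω ∂ℙ) atTop (nhds (w j i * C)) := fun j _ => by
      rcases (hw j i).eq_or_lt with h | h
      · simp [← h]
      · exact (hC j (.inl h)).const_mul _
    simpa [← Finset.sum_mul, hsum] using tendsto_finsetSum _ hterm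
  have hk : β i * γ * (1 / (N : ℝ)) ≠ 0 := by
    have hβ0 : β i ≠ 0 := by rcases hβ i with h | h <;> simp [h]
    have hN : (N : ℝ) ≠ 0 := NeZero.ne _
    positivity
  have hsumlim : Tendsto (fun t => ∑ j, ∫ ω, S j t ω ∂ℙ) atTop (nhds 0) := by
    have h := ((((tendsto_add_atTop_iff_nat 1).2 (hC i (.inr rfl))).sub hneigh).const_mul
      (β i * γ * (1 / (N : ℝ)))⁻¹)
    rw [sub_self, mul_zero] at h
    refine h.congr fun t => ?_
    rw [hmean t, add_sub_cancel_right, ← mul_assoc (β i * γ), inv_mul_cancel_left₀ hk]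
  have hSlim : Tendsto (fun t => ∫ ω, S i t ω ∂ℙ) atTop (nhds 0) :=
    squeeze_zero (hSnonneg i)
      (fun t => Finset.single_le_sum (f := fun j => ∫ ω, S j t ω ∂ℙ)
        (fun j _ => hSnonneg j t) (Finset.mem_univ i)) hsumlim
  exact not_tendsto_nhds_of_tendsto_atBot
    (tendsto_integral_atBot_of_logistic hlam (hXmeas i) (hXint i) (hUI i).unifIntegrable
      (hSlim.congr (hEGM i))) C (hC i (.inr rfl))
end

section
/- (No consensus under GSM.) Assume the GSM-DeGroot dynamics: almost surely, X_{i,t+1} = β_i·γ·S̃_t + Σ_{j=1}^N w_{ji} X_{j,t} for all agents i and times t, with nonnegative weights satisfying Σ_{j=1}^N w_{ji} = 1 for every i, reactions β_i ∈ {−1, 1} for all i, γ > 0 and λ > 0; assume also that for each agent i the family of positive parts {max(X_{i,t}, 0) : t ∈ ℕ} is uniformly integrable. Then consensus is impossible: there exists no real number C such that E[X_{i,t}] → C as t → ∞ for every agent i. -/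
open MeasureTheory Filter

/-- A pointwise bound on `x` by its positive part and the sigmoid at `lam * x`. -/
theorem le_posPart_sub_add_sigmoid {lam M : ℝ} (hlam : 0 < lam) (hM : 0 ≤ M) (x : ℝ) :
    x ≤ max x 0 - M + M * (1 + Real.exp (lam * M)) * (1 / (1 + Real.exp (-lam * x))) := by
  have hx := Real.exp_pos (-lam * x)
  have hK := Real.exp_pos (lam * M)
  rcases le_or_gt (-M) x with h | h
  · have hexp : Real.exp (-lam * x) ≤ Real.exp (lam * M) :=
      Real.exp_le_exp.2 (by nlinarith)
    have hge : M ≤ M * (1 + Real.exp (lam * M)) * (1 / (1 + Real.exp (-lam * x))) := by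
      rw [mul_one_div, le_div_iff₀ (by linarith)]
      gcongr
    linarith [le_max_left x 0]
  · have hnn : 0 ≤ M * (1 + Real.exp (lam * M)) * (1 / (1 + Real.exp (-lam * x))) := by
      positivity
    linarith [le_max_right x 0]

/-- The sigmoid of a measurable function is integrable on a finite measure space. -/
theorem integrable_sigmoid {Ω : Type*} [MeasurableSpace Ω] {μ : Measure Ω} [IsFiniteMeasure μ]
    {Y : Ω → ℝ} (hY : Measurable Y) (lam : ℝ) :
    Integrable (fun ω => 1 / (1 + Real.exp (-lam * Y ω))) μ := by
  refine Integrable.of_bound (C := 1) (Measurable.aestronglyMeasurable (by fun_prop))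
    (ae_of_all _ fun ω => ?_)
  have h := Real.exp_pos (-lam * Y ω)
  rw [Real.norm_of_nonneg (by positivity), div_le_one (by linarith)]
  linarith

/-- If the positive parts of `Y t` are uniformly integrable and the expected sigmoids vanish in the
limit, then the expectations of `Y t` cannot converge. -/
theorem not_tendsto_integral_of_tendsto_integral_sigmoid
    {Ω : Type*} [MeasurableSpace Ω] {μ : Measure Ω} [IsProbabilityMeasure μ]
    {Y : ℕ → Ω → ℝ} (hmeas : ∀ t, Measurable (Y t)) (hint : ∀ t, Integrable (Y t) μ)
    {lam : ℝ} (hlam : 0 < lam) (hUI : UniformIntegrable (fun t ω => max (Y t ω) 0) 1 μ)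
    (hsig : Tendsto (fun t => ∫ ω, 1 / (1 + Real.exp (-lam * Y t ω)) ∂μ) atTop (nhds 0))
    (C : ℝ) : ¬ Tendsto (fun t => ∫ ω, Y t ω ∂μ) atTop (nhds C) := by
  intro hC
  obtain ⟨B, hB⟩ := hUI.2.2
  have hpos : ∀ t, Integrable (fun ω => max (Y t ω) 0) μ := fun t => (hint t).pos_part
  have hposB : ∀ t, ∫ ω, max (Y t ω) 0 ∂μ ≤ B := fun t => by
    have h := hB t
    rw [eLpNorm_one_eq_lintegral_enorm] at h
    refine (le_abs_self _).trans ?_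
    rw [← Real.norm_eq_abs, ← coe_nnnorm, NNReal.coe_le_coe, ← ENNReal.coe_le_coe]
    exact (enorm_integral_le_lintegral_enorm _).trans h
  have key : ∀ M : ℝ, 0 ≤ M → C ≤ B - M := fun M hM => by
    have hle : ∀ t, ∫ ω, Y t ω ∂μ ≤ B - M +
        M * (1 + Real.exp (lam * M)) * ∫ ω, 1 / (1 + Real.exp (-lam * Y t ω)) ∂μ := fun t => by
      have hs := (integrable_sigmoid (μ := μ) (hmeas t) lam).const_mul
        (M * (1 + Real.exp (lam * M)))
      have hd : Integrable (fun ω => max (Y t ω) 0 - M) μ := (hpos t).sub (integrable_const M)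
      have h := integral_mono (hint t) (hd.add hs)
        fun ω => le_posPart_sub_add_sigmoid hlam hM (Y t ω)
      rw [integral_add' hd hs, integral_sub (hpos t) (integrable_const M), integral_const_mul,
        integral_const, probReal_univ, one_smul] at h
      linarith [hposB t]
    have hlim := (hsig.const_mul (M * (1 + Real.exp (lam * M)))).const_add (B - M)
    rw [mul_zero, add_zero] at hlim
    exact le_of_tendsto_of_tendsto' hC hlim hle
  have h := key (|B - C| + 1) (by positivity)
  linarith [le_abs_self (B - C)]

/-- **No consensus under GSM.** Under the GSM-DeGroot dynamics with normalized
nonnegative weights, reactions `β_i ∈ {−1,1}`, `γ > 0`, `λ > 0`, the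
event-generation mechanism, and uniformly integrable positive parts, there is no
real number `C` to which all expected opinions converge. -/
theorem gsm_degroot_no_consensus
    {Ω : Type*} [MeasurableSpace Ω] (ℙ : Measure Ω) [IsProbabilityMeasure ℙ]
    (N : ℕ) [NeZero N]
    (X : Fin N → ℕ → Ω → ℝ) (S : Fin N → ℕ → Ω → ℝ)
    (hXmeas : ∀ i t, Measurable (X i t)) (hXint : ∀ i t, Integrable (X i t) ℙ)
    (hSmeas : ∀ i t, Measurable (S i t))
    (hS01 : ∀ i t ω, S i t ω = 0 ∨ S i t ω = 1)
    (lam γ : ℝ) (hlam : 0 < lam) (hγ : 0 < γ)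
    (β : Fin N → ℝ) (hβ : ∀ i, β i = 1 ∨ β i = -1)
    (w : Fin N → Fin N → ℝ) (hw : ∀ j i, 0 ≤ w j i)
    (hsum : ∀ i, ∑ j, w j i = 1)
    (hEGM : ∀ i t,
      ∫ ω, S i t ω ∂ℙ = ∫ ω, 1 / (1 + Real.exp (-lam * X i t ω)) ∂ℙ)
    (hdyn : ∀ᵐ ω ∂ℙ, ∀ (i : Fin N) (t : ℕ),
      X i (t + 1) ω = β i * γ * ((1 / (N : ℝ)) * ∑ j, S j t ω) + ∑ j, w j i * X j t ω)
    (hUI : ∀ i, UniformIntegrable (fun t ω => max (X i t ω) 0) 1 ℙ) :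
    ¬ ∃ C : ℝ, ∀ i : Fin N,
        Tendsto (fun t => ∫ ω, X i t ω ∂ℙ) atTop (nhds C) := by
  rintro ⟨C, hC⟩
  have hSint : ∀ i t, Integrable (S i t) ℙ := fun i t => by
    refine Integrable.of_bound (C := 1) (hSmeas i t).aestronglyMeasurable
      (ae_of_all _ fun ω => ?_)
    rcases hS01 i t ω with h | h <;> simp [h]
  have hSnn : ∀ i t, 0 ≤ ∫ ω, S i t ω ∂ℙ := fun i t => integral_nonneg fun ω => by
    rcases hS01 i t ω with h | h <;> simp [h]
  have hN : (0 : ℝ) < N := Nat.cast_pos.2 (Nat.pos_of_ne_zero (NeZero.ne N))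
  have hmean : ∀ t, ∫ ω, X 0 (t + 1) ω ∂ℙ =
      β 0 * γ * ((1 / (N : ℝ)) * ∑ j, ∫ ω, S j t ω ∂ℙ) +
        ∑ j, w j 0 * ∫ ω, X j t ω ∂ℙ := fun t => by
    rw [integral_congr_ae (hdyn.mono fun ω h => h 0 t), integral_add, integral_const_mul,
      integral_const_mul, integral_finsetSum _ fun j _ => hSint j t,
      integral_finsetSum _ fun j _ => (hXint j t).const_mul _]
    · simp only [integral_const_mul]
    · exact ((integrable_finsetSum _ fun j _ => hSint j t).const_mul _).const_mul _
    · exact integrable_finsetSum _ fun j _ => (hXint j t).const_mul _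
  have hβsq : β 0 * β 0 = 1 := by rcases hβ 0 with h | h <;> simp [h]
  have hsumS : ∀ t, ∑ j, ∫ ω, S j t ω ∂ℙ =
      N / γ * β 0 * (∫ ω, X 0 (t + 1) ω ∂ℙ - ∑ j, w j 0 * ∫ ω, X j t ω ∂ℙ) := fun t => by
    rw [hmean t]
    field_simp
    linear_combination (-γ * ∑ j, ∫ ω, S j t ω ∂ℙ) * hβsq
  have havg : Tendsto (fun t => ∑ j, w j 0 * ∫ ω, X j t ω ∂ℙ) atTop (nhds C) := by
    have h := tendsto_finsetSum Finset.univ fun j _ => (hC j).const_mul (w j 0)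
    rwa [← Finset.sum_mul, hsum 0, one_mul] at h
  have hlim : Tendsto (fun t => ∑ j, ∫ ω, S j t ω ∂ℙ) atTop (nhds 0) := by
    have h := (((tendsto_add_atTop_iff_nat 1).2 (hC 0)).sub havg).const_mul (N / γ * β 0)
    rw [sub_self, mul_zero] at h
    exact h.congr fun t => (hsumS t).symm
  have hS0 : Tendsto (fun t => ∫ ω, S 0 t ω ∂ℙ) atTop (nhds 0) :=
    squeeze_zero (hSnn 0)
      (fun t => Finset.single_le_sum (f := fun j => ∫ ω, S j t ω ∂ℙ)
        (fun j _ => hSnn j t) (Finset.mem_univ 0)) hlim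
  exact not_tendsto_integral_of_tendsto_integral_sigmoid (hXmeas 0) (hXint 0) hlam (hUI 0)
    (hS0.congr (hEGM 0)) C (hC 0)
end

section
/- (Reactions of the extremal agents.) Assume the GSM-DeGroot dynamics: almost surely, X_{i,t+1} = β_i·γ·S̃_t + Σ_{j=1}^N w_{ji} X_{j,t} for all agents i and times t, with nonnegative weights satisfying Σ_{j=1}^N w_{ji} = 1 for every i, and reactions β_i ∈ {−1, 1} for all i. Suppose that for every agent i the limit C_i = lim_{t→∞} E[X_{i,t}] exists and is finite, and that E[γ·S̃_t] → L as t → ∞ with L > 0. Then any agent i with C_i = min_{j} C_j satisfies β_i = −1, and any agent i with C_i = max_{j} C_j satisfies β_i = 1. -/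
open MeasureTheory Filter

/-- A random variable with values in `{0, 1}` is integrable. -/
theorem integrable_of_eq_zero_or_one {Ω : Type*} [MeasurableSpace Ω] {μ : Measure Ω}
    [IsFiniteMeasure μ] {f : Ω → ℝ} (hf : Measurable f) (h01 : ∀ ω, f ω = 0 ∨ f ω = 1) :
    Integrable f μ := by
  refine Integrable.of_bound hf.aestronglyMeasurable 1 (Eventually.of_forall fun ω => ?_)
  rcases h01 ω with h | h <;> simp [h]

/-- A weighted average of values that are all at least `c` is at least `c`. -/
theorem le_sum_mul_of_sum_eq_one {ι : Type*} [Fintype ι] {w C : ι → ℝ} {c : ℝ}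
    (hw : ∀ j, 0 ≤ w j) (hsum : ∑ j, w j = 1) (hc : ∀ j, c ≤ C j) :
    c ≤ ∑ j, w j * C j := by
  calc c = ∑ j, w j * c := by rw [← Finset.sum_mul, hsum, one_mul]
    _ ≤ ∑ j, w j * C j :=
      Finset.sum_le_sum fun j _ => mul_le_mul_of_nonneg_left (hc j) (hw j)

/-- A weighted average of values that are all at most `c` is at most `c`. -/
theorem sum_mul_le_of_sum_eq_one {ι : Type*} [Fintype ι] {w C : ι → ℝ} {c : ℝ}
    (hw : ∀ j, 0 ≤ w j) (hsum : ∑ j, w j = 1) (hc : ∀ j, C j ≤ c) :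
    ∑ j, w j * C j ≤ c := by
  calc ∑ j, w j * C j ≤ ∑ j, w j * c :=
      Finset.sum_le_sum fun j _ => mul_le_mul_of_nonneg_left (hc j) (hw j)
    _ = c := by rw [← Finset.sum_mul, hsum, one_mul]

/-- **Reactions of the extremal agents.** Under the GSM-DeGroot dynamics, if all
expected opinions converge to finite limits `C_i` and the expected steering
strength `E[γ·S̃_t]` converges to some `L > 0`, then any agent attaining the
minimal limit reacts negatively (`β_i = −1`) and any agent attaining the maximal
limit reacts positively (`β_i = 1`). -/
theorem gsm_degroot_extremal_reactions
    {Ω : Type*} [MeasurableSpace Ω] (ℙ : Measure Ω) [IsProbabilityMeasure ℙ]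
    (N : ℕ) [NeZero N]
    (X : Fin N → ℕ → Ω → ℝ) (S : Fin N → ℕ → Ω → ℝ)
    (hXmeas : ∀ i t, Measurable (X i t)) (hXint : ∀ i t, Integrable (X i t) ℙ)
    (hSmeas : ∀ i t, Measurable (S i t))
    (hS01 : ∀ i t ω, S i t ω = 0 ∨ S i t ω = 1)
    (lam γ : ℝ) (hlam : 0 < lam) (hγ : 0 < γ)
    (β : Fin N → ℝ) (hβ : ∀ i, β i = 1 ∨ β i = -1)
    (w : Fin N → Fin N → ℝ) (hw : ∀ j i, 0 ≤ w j i)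
    (hsum : ∀ i, ∑ j, w j i = 1)
    (hdyn : ∀ᵐ ω ∂ℙ, ∀ (i : Fin N) (t : ℕ),
      X i (t + 1) ω = β i * γ * ((1 / (N : ℝ)) * ∑ j, S j t ω) + ∑ j, w j i * X j t ω)
    (C : Fin N → ℝ)
    (hC : ∀ i, Tendsto (fun t => ∫ ω, X i t ω ∂ℙ) atTop (nhds (C i)))
    (L : ℝ) (hLpos : 0 < L)
    (hL : Tendsto (fun t => ∫ ω, γ * ((1 / (N : ℝ)) * ∑ j, S j t ω) ∂ℙ)
      atTop (nhds L)) :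
    (∀ i : Fin N, (∀ j, C i ≤ C j) → β i = -1) ∧
    (∀ i : Fin N, (∀ j, C j ≤ C i) → β i = 1) := by
  have hSint : ∀ t, Integrable (fun ω => γ * ((1 / (N : ℝ)) * ∑ j, S j t ω)) ℙ := fun t =>
    ((integrable_finsetSum _ fun j _ =>
      integrable_of_eq_zero_or_one (hSmeas j t) (hS01 j t)).const_mul _).const_mul _
  have hmean : ∀ i t, ∫ ω, X i (t + 1) ω ∂ℙ =
      β i * ∫ ω, γ * ((1 / (N : ℝ)) * ∑ j, S j t ω) ∂ℙ + ∑ j, w j i * ∫ ω, X j t ω ∂ℙ := by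
    intro i t
    have hwX : ∀ j ∈ Finset.univ, Integrable (fun ω => w j i * X j t ω) ℙ :=
      fun j _ => (hXint j t).const_mul _
    calc ∫ ω, X i (t + 1) ω ∂ℙ
        = ∫ ω, (β i * (γ * ((1 / (N : ℝ)) * ∑ j, S j t ω)) + ∑ j, w j i * X j t ω) ∂ℙ := by
          refine integral_congr_ae ?_
          filter_upwards [hdyn] with ω hω
          rw [hω i t, mul_assoc]
      _ = _ := by
          rw [integral_add ((hSint t).const_mul _) (integrable_finsetSum _ hwX),
            integral_const_mul, integral_finsetSum _ hwX]
          simp only [integral_const_mul]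
  have hfix : ∀ i, C i = β i * L + ∑ j, w j i * C j := by
    intro i
    refine tendsto_nhds_unique ((tendsto_add_atTop_iff_nat 1).2 (hC i)) ?_
    simp only [hmean]
    exact (hL.const_mul _).add (tendsto_finsetSum _ fun j _ => (hC j).const_mul _)
  refine ⟨fun i hi => (hβ i).resolve_left fun h => ?_,
    fun i hi => (hβ i).resolve_right fun h => ?_⟩
  · have hle := le_sum_mul_of_sum_eq_one (fun j => hw j i) (hsum i) hi
    have heq := hfix i
    rw [h] at heq
    linarith
  · have hle := sum_mul_le_of_sum_eq_one (fun j => hw j i) (hsum i) hi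
    have heq := hfix i
    rw [h] at heq
    linarith
end

section
/- (Boundary on ε-consensus.) Assume the GSM-DeGroot dynamics: almost surely, X_{i,t+1} = β_i·γ·S̃_t + Σ_{j=1}^N w_{ji} X_{j,t} for all agents i and times t, with nonnegative weights satisfying Σ_{j=1}^N w_{ji} = 1 for every i, reactions β_i ∈ {−1, 1} for all i, γ > 0 and λ > 0; assume also that for each agent i the family of positive parts {max(X_{i,t}, 0) : t ∈ ℕ} is uniformly integrable. Suppose that for every agent i the limit C_i = lim_{t→∞} E[X_{i,t}] exists and is finite. Then the limit L = lim_{t→∞} E[γ·S̃_t] exists, and the final polarization satisfies max_{i} C_i − min_{j} C_j ≥ L; that is, no ε-consensus with ε < L is possible. -/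
open MeasureTheory Filter

/-- **Boundary on ε-consensus.** Under the GSM-DeGroot dynamics with normalized
nonnegative weights, reactions `β_i ∈ {−1,1}`, `γ > 0`, `λ > 0`, the
event-generation mechanism and uniformly integrable positive parts, if all the
expected opinions converge to finite limits `C_i`, then the expected steering
strength `E[γ·S̃_t]` converges to some limit `L`, and the final polarization
satisfies `max_i C_i − min_j C_j ≥ L` (no ε-consensus with `ε < L` is possible). -/
theorem gsm_degroot_epsilon_consensus_bound
    {Ω : Type*} [MeasurableSpace Ω] (ℙ : Measure Ω) [IsProbabilityMeasure ℙ]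
    (N : ℕ) [NeZero N]
    (X : Fin N → ℕ → Ω → ℝ) (S : Fin N → ℕ → Ω → ℝ)
    (hXmeas : ∀ i t, Measurable (X i t)) (hXint : ∀ i t, Integrable (X i t) ℙ)
    (hSmeas : ∀ i t, Measurable (S i t))
    (hS01 : ∀ i t ω, S i t ω = 0 ∨ S i t ω = 1)
    (lam γ : ℝ) (hlam : 0 < lam) (hγ : 0 < γ)
    (β : Fin N → ℝ) (hβ : ∀ i, β i = 1 ∨ β i = -1)
    (w : Fin N → Fin N → ℝ) (hw : ∀ j i, 0 ≤ w j i)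
    (hsum : ∀ i, ∑ j, w j i = 1)
    (hEGM : ∀ i t,
      ∫ ω, S i t ω ∂ℙ = ∫ ω, 1 / (1 + Real.exp (-lam * X i t ω)) ∂ℙ)
    (hdyn : ∀ᵐ ω ∂ℙ, ∀ (i : Fin N) (t : ℕ),
      X i (t + 1) ω = β i * γ * ((1 / (N : ℝ)) * ∑ j, S j t ω) + ∑ j, w j i * X j t ω)
    (hUI : ∀ i, UniformIntegrable (fun t ω => max (X i t ω) 0) 1 ℙ)
    (C : Fin N → ℝ)
    (hC : ∀ i, Tendsto (fun t => ∫ ω, X i t ω ∂ℙ) atTop (nhds (C i))) :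
    ∃ L : ℝ,
      Tendsto (fun t => ∫ ω, γ * ((1 / (N : ℝ)) * ∑ j, S j t ω) ∂ℙ)
        atTop (nhds L) ∧
      L ≤ Finset.univ.sup' Finset.univ_nonempty C -
            Finset.univ.inf' Finset.univ_nonempty C := by
  obtain ⟨i⟩ : Nonempty (Fin N) := inferInstance
  have hSint : ∀ j t, Integrable (S j t) ℙ := fun j t =>
    Integrable.of_bound (hSmeas j t).aestronglyMeasurable 1
      (ae_of_all _ fun ω => by rcases hS01 j t ω with h | h <;> simp [h])
  have hTint : ∀ t, Integrable (fun ω => γ * ((1 / (N : ℝ)) * ∑ j, S j t ω)) ℙ := fun t =>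
    ((integrable_finsetSum _ fun j _ => hSint j t).const_mul _).const_mul _
  have hmean : ∀ t, ∫ ω, X i (t + 1) ω ∂ℙ =
      β i * ∫ ω, γ * ((1 / (N : ℝ)) * ∑ j, S j t ω) ∂ℙ + ∑ j, w j i * ∫ ω, X j t ω ∂ℙ := by
    intro t
    have hXw : ∀ j ∈ Finset.univ, Integrable (fun ω => w j i * X j t ω) ℙ :=
      fun j _ => (hXint j t).const_mul _
    calc ∫ ω, X i (t + 1) ω ∂ℙ
        = ∫ ω, (β i * (γ * ((1 / (N : ℝ)) * ∑ j, S j t ω)) + ∑ j, w j i * X j t ω) ∂ℙ := by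
          refine integral_congr_ae ?_
          filter_upwards [hdyn] with ω hω
          rw [hω i t, mul_assoc]
      _ = _ := by
          rw [integral_add ((hTint t).const_mul _) (integrable_finsetSum _ hXw),
            integral_const_mul, integral_finsetSum _ hXw]
          simp only [integral_const_mul]
  have hβsq : β i * β i = 1 := by rcases hβ i with h | h <;> simp [h]
  refine ⟨β i * (C i - ∑ j, w j i * C j), ?_, ?_⟩
  · have hlim : Tendsto
        (fun t => β i * (∫ ω, X i (t + 1) ω ∂ℙ - ∑ j, w j i * ∫ ω, X j t ω ∂ℙ))
        atTop (nhds (β i * (C i - ∑ j, w j i * C j))) :=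
      (((tendsto_add_atTop_iff_nat 1).2 (hC i)).sub
        (tendsto_finsetSum _ fun j _ => (hC j).const_mul _)).const_mul _
    refine hlim.congr fun t => ?_
    rw [hmean t, add_sub_cancel_right, ← mul_assoc, hβsq, one_mul]
  · have hle : ∀ j, C j ≤ Finset.univ.sup' Finset.univ_nonempty C :=
      fun j => Finset.le_sup' C (Finset.mem_univ j)
    have hge : ∀ j, Finset.univ.inf' Finset.univ_nonempty C ≤ C j :=
      fun j => Finset.inf'_le C (Finset.mem_univ j)
    have hupper : ∑ j, w j i * C j ≤ Finset.univ.sup' Finset.univ_nonempty C := by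
      calc _ ≤ ∑ j, w j i * Finset.univ.sup' Finset.univ_nonempty C :=
            Finset.sum_le_sum fun j _ => mul_le_mul_of_nonneg_left (hle j) (hw j i)
        _ = _ := by rw [← Finset.sum_mul, hsum, one_mul]
    have hlower : Finset.univ.inf' Finset.univ_nonempty C ≤ ∑ j, w j i * C j := by
      calc _ = ∑ j, w j i * Finset.univ.inf' Finset.univ_nonempty C := by
            rw [← Finset.sum_mul, hsum, one_mul]
        _ ≤ _ := Finset.sum_le_sum fun j _ => mul_le_mul_of_nonneg_left (hge j) (hw j i)
    rcases hβ i with h | h <;> rw [h] <;> linarith [hle i, hge i]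
end

section
/- (Bounded polarization under full stubbornness.) Let G be a strongly connected weighted digraph on N nodes with nonnegative weights, normalized incoming sums (Σ_{j=1}^N w_{ji} = 1 for every i), and positive self-loops (w_{kk} > 0 for every k). Let 𝒮 be a nonempty subset of the nodes of fully stubborn agents, whose opinions are fixed: X_{k,t} = X_{k,0} for all k ∈ 𝒮 and all t; every other agent i ∉ 𝒮 updates by the DeGroot rule X_{i,t+1} = Σ_{j=1}^N w_{ji} X_{j,t}. Then lim sup_{t→∞} max_{i} X_{i,t} ≤ max_{k∈𝒮} X_{k,0} and lim inf_{t→∞} min_{i} X_{i,t} ≥ min_{k∈𝒮} X_{k,0}; consequently, the polarization is eventually bounded by the stubborn spread: lim sup_{t→∞} ( max_{i} X_{i,t} − min_{j} X_{j,t} ) ≤ max_{k∈𝒮} X_{k,0} − min_{k∈𝒮} X_{k,0}. -/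
open Filter

/-- Minimum opinion over the (nonempty) set of agents at time `t`. -/
noncomputable def minOp {N : ℕ} [NeZero N] (X : Fin N → ℕ → ℝ) (t : ℕ) : ℝ :=
  Finset.univ.inf' Finset.univ_nonempty fun i => X i t

/-- Maximum opinion over the (nonempty) set of agents at time `t`. -/
noncomputable def maxOp {N : ℕ} [NeZero N] (X : Fin N → ℕ → ℝ) (t : ℕ) : ℝ :=
  Finset.univ.sup' Finset.univ_nonempty fun i => X i t

/-- The opinions stay uniformly bounded. -/
lemma exists_forall_abs_opinion_le {ι : Type*} [Fintype ι]
    {w : ι → ι → ℝ} (hw : ∀ j i, 0 ≤ w j i) (hsum : ∀ i, ∑ j, w j i = 1)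
    {S : Finset ι} {X : ι → ℕ → ℝ}
    (hstub : ∀ k ∈ S, ∀ t : ℕ, X k t = X k 0)
    (hupd : ∀ i ∉ S, ∀ t : ℕ, X i (t + 1) = ∑ j, w j i * X j t) :
    ∃ B : ℝ, ∀ t i, |X i t| ≤ B := by
  have h0 : ∀ i, |X i 0| ≤ ∑ j, |X j 0| := fun i =>
    Finset.single_le_sum (f := fun j => |X j 0|) (fun j _ => abs_nonneg _) (Finset.mem_univ i)
  refine ⟨∑ j, |X j 0|, fun t => ?_⟩
  induction t with
  | zero => exact h0
  | succ t ih =>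
    intro i
    by_cases hi : i ∈ S
    · rw [hstub i hi]
      exact h0 i
    · rw [hupd i hi]
      calc |∑ j, w j i * X j t| ≤ ∑ j, |w j i * X j t| := Finset.abs_sum_le_sum_abs _ _
        _ ≤ ∑ j, w j i * ∑ k, |X k 0| := by
          refine Finset.sum_le_sum fun j _ => ?_
          rw [abs_mul, abs_of_nonneg (hw j i)]
          exact mul_le_mul_of_nonneg_left (ih j) (hw j i)
        _ = ∑ k, |X k 0| := by rw [← Finset.sum_mul, hsum, one_mul]

/-- Maximum principle: a function that is subharmonic off `S` is bounded by any bound it has on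
`S`, provided every node can be reached from `S`. -/
lemma le_of_subharmonic_off {ι : Type*} [Fintype ι]
    {w : ι → ι → ℝ} (hw : ∀ j i, 0 ≤ w j i) (hsum : ∀ i, ∑ j, w j i = 1)
    {S : Finset ι}
    (hreach : ∀ i, ∃ k ∈ S, Relation.ReflTransGen (fun a b => 0 < w a b) k i)
    {L : ι → ℝ} {C : ℝ} (hS : ∀ k ∈ S, L k ≤ C)
    (hsub : ∀ i ∉ S, L i ≤ ∑ j, w j i * L j) (i : ι) : L i ≤ C := by
  have : Nonempty ι := ⟨i⟩
  obtain ⟨m, hm⟩ := Finite.exists_max L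
  refine (hm i).trans (le_of_not_gt fun hC => ?_)
  obtain ⟨k, hk, hkm⟩ := hreach m
  have hLk : L k = L m := by
    clear hk
    induction hkm using Relation.ReflTransGen.head_induction_on with
    | refl => rfl
    | @head a c hac _ ih =>
      have hc : c ∉ S := fun h => (hS c h).not_gt (ih ▸ hC)
      refine (hm a).eq_of_not_lt fun hlt => (hsub c hc).not_gt ?_
      calc ∑ j, w j c * L j < ∑ j, w j c * L m :=
            Finset.sum_lt_sum (fun j _ => mul_le_mul_of_nonneg_left (hm j) (hw j c))
              ⟨a, Finset.mem_univ a, mul_lt_mul_of_pos_left hlt hac⟩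
        _ = L c := by rw [← Finset.sum_mul, hsum, one_mul, ih]
  exact (hS k hk).not_gt (hLk ▸ hC)

/-- Asymptotically, opinions do not exceed a bound on the stubborn opinions. -/
lemma eventually_forall_opinion_le {ι : Type*} [Fintype ι]
    {w : ι → ι → ℝ} (hw : ∀ j i, 0 ≤ w j i) (hsum : ∀ i, ∑ j, w j i = 1)
    {S : Finset ι}
    (hreach : ∀ i, ∃ k ∈ S, Relation.ReflTransGen (fun a b => 0 < w a b) k i)
    {X : ι → ℕ → ℝ} (hstub : ∀ k ∈ S, ∀ t : ℕ, X k t = X k 0)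
    (hupd : ∀ i ∉ S, ∀ t : ℕ, X i (t + 1) = ∑ j, w j i * X j t)
    {C : ℝ} (hC : ∀ k ∈ S, X k 0 ≤ C) {ε : ℝ} (hε : 0 < ε) :
    ∀ᶠ t in atTop, ∀ i, X i t ≤ C + ε := by
  obtain ⟨B, hB⟩ := exists_forall_abs_opinion_le hw hsum hstub hupd
  have hbdd : ∀ i, IsBoundedUnder (· ≤ ·) atTop (X i) := fun i =>
    isBoundedUnder_of ⟨B, fun t => (abs_le.1 (hB t i)).2⟩
  have hcobdd : ∀ i, IsCoboundedUnder (· ≤ ·) atTop (X i) := fun i =>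
    (isBoundedUnder_of ⟨-B, fun t => (abs_le.1 (hB t i)).1⟩ :
      IsBoundedUnder (· ≥ ·) atTop (X i)).isCoboundedUnder_le
  have hlt : ∀ δ > 0, ∀ᶠ t in atTop, ∀ i, X i t ≤ limsup (X i) atTop + δ := fun δ hδ =>
    eventually_all.2 fun i =>
      (eventually_lt_of_limsup_lt (lt_add_of_pos_right _ hδ) (hbdd i)).mono fun _ h => h.le
  have hL : ∀ i, limsup (X i) atTop ≤ C := by
    refine le_of_subharmonic_off hw hsum hreach (fun k hk => ?_) fun i hi => ?_
    · exact limsup_le_of_le (hcobdd k) (.of_forall fun t => (hstub k hk t).trans_le (hC k hk))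
    · refine le_of_forall_pos_le_add fun δ hδ => limsup_le_of_le (hcobdd i) ?_
      refine (map_add_atTop_eq_nat 1).ge (eventually_map.2 ?_)
      filter_upwards [hlt δ hδ] with t ht
      rw [hupd i hi]
      calc ∑ j, w j i * X j t ≤ ∑ j, w j i * (limsup (X j) atTop + δ) :=
            Finset.sum_le_sum fun j _ => mul_le_mul_of_nonneg_left (ht j) (hw j i)
        _ = ∑ j, w j i * limsup (X j) atTop + δ := by
            simp_rw [mul_add, Finset.sum_add_distrib]
            rw [← Finset.sum_mul, hsum, one_mul]
  filter_upwards [hlt ε hε] with t ht i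
  exact (ht i).trans (by linarith [hL i])

/-- **Bounded polarization under full stubbornness.** In a strongly connected
weighted digraph with normalized nonnegative incoming weights and positive
self-loops, if a nonempty set `𝒮` of fully stubborn agents keeps fixed opinions
while all other agents follow the DeGroot rule, then asymptotically every opinion
lies between the extreme stubborn opinions, so the polarization is eventually
bounded by the stubborn spread. -/
theorem degroot_bounded_polarization_full_stubbornness
    (N : ℕ) [NeZero N]
    (w : Fin N → Fin N → ℝ) (hw : ∀ j i, 0 ≤ w j i)
    (hsum : ∀ i, ∑ j, w j i = 1)
    (hself : ∀ k, 0 < w k k)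
    (hconn : ∀ i j : Fin N, Relation.ReflTransGen (fun a b => 0 < w a b) i j)
    (𝒮 : Finset (Fin N)) (h𝒮 : 𝒮.Nonempty)
    (X : Fin N → ℕ → ℝ)
    (hstub : ∀ k ∈ 𝒮, ∀ t : ℕ, X k t = X k 0)
    (hupd : ∀ i ∉ 𝒮, ∀ t : ℕ, X i (t + 1) = ∑ j, w j i * X j t) :
    limsup (fun t => maxOp X t) atTop ≤ 𝒮.sup' h𝒮 (fun k => X k 0) ∧
    𝒮.inf' h𝒮 (fun k => X k 0) ≤ liminf (fun t => minOp X t) atTop ∧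
    limsup (fun t => maxOp X t - minOp X t) atTop ≤
      𝒮.sup' h𝒮 (fun k => X k 0) - 𝒮.inf' h𝒮 (fun k => X k 0) := by
  obtain ⟨k₀, hk₀⟩ := id h𝒮
  have hreach : ∀ i, ∃ k ∈ 𝒮, Relation.ReflTransGen (fun a b => 0 < w a b) k i :=
    fun i => ⟨k₀, hk₀, hconn k₀ i⟩
  obtain ⟨B, hB⟩ := exists_forall_abs_opinion_le hw hsum hstub hupd
  set C := 𝒮.sup' h𝒮 fun k => X k 0
  set c := 𝒮.inf' h𝒮 fun k => X k 0
  have hX_le_max : ∀ i t, X i t ≤ maxOp X t := fun i t =>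
    Finset.le_sup' (fun i => X i t) (Finset.mem_univ i)
  have hmin_le_X : ∀ i t, minOp X t ≤ X i t := fun i t =>
    Finset.inf'_le (fun i => X i t) (Finset.mem_univ i)
  have hmax : ∀ ε > 0, ∀ᶠ t in atTop, maxOp X t ≤ C + ε := fun ε hε =>
    (eventually_forall_opinion_le hw hsum hreach hstub hupd
      (fun k hk => Finset.le_sup' (fun k => X k 0) hk) hε).mono
      fun t ht => Finset.sup'_le _ _ fun i _ => ht i
  have hmin : ∀ ε > 0, ∀ᶠ t in atTop, c - ε ≤ minOp X t := fun ε hε => by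
    refine (eventually_forall_opinion_le (X := fun i t => -X i t) (C := -c) hw hsum hreach
      (fun k hk t => by rw [hstub k hk t]) (fun i hi t => by simp [hupd i hi t])
      (fun k hk => neg_le_neg (Finset.inf'_le (fun k => X k 0) hk)) hε).mono
      fun t ht => Finset.le_inf' _ _ fun i _ => ?_
    linarith [ht i]
  refine ⟨?_, ?_, ?_⟩
  · refine le_of_forall_pos_le_add fun ε hε => limsup_le_of_le ?_ (hmax ε hε)
    exact (isBoundedUnder_of ⟨-B, fun t => (abs_le.1 (hB t k₀)).1.trans (hX_le_max k₀ t)⟩ :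
      IsBoundedUnder (· ≥ ·) atTop (maxOp X)).isCoboundedUnder_le
  · refine le_of_forall_pos_le_add fun ε hε => sub_le_iff_le_add.1 <| le_liminf_of_le ?_ (hmin ε hε)
    exact (isBoundedUnder_of ⟨B, fun t => (hmin_le_X k₀ t).trans (abs_le.1 (hB t k₀)).2⟩ :
      IsBoundedUnder (· ≤ ·) atTop (minOp X)).isCoboundedUnder_ge
  · refine le_of_forall_pos_le_add fun ε hε => limsup_le_of_le ?_ ?_
    · exact (isBoundedUnder_of
        ⟨0, fun t => sub_nonneg.2 ((hmin_le_X k₀ t).trans (hX_le_max k₀ t))⟩ :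
        IsBoundedUnder (· ≥ ·) atTop fun t => maxOp X t - minOp X t).isCoboundedUnder_le
    · filter_upwards [hmax (ε / 2) (half_pos hε), hmin (ε / 2) (half_pos hε)] with t h₁ h₂
      linarith
end
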